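/- For every t ≥ 2, ⟨∇f(x_t), m_t⟩ ≤ μ ⟨∇f(x_{t−1}), m_{t−1}⟩ + (1 + (3/2)λμ) μ L ‖m_{t−1}‖² + (1/2) λ μ² L ‖m_{t−2}‖² − ⟨∇f(x_t), p_t⟩. -/

import Mathlib

open Finset
open scoped RealInnerProductSpace

/-- Change of `⟪G ·, a⟫` under an `L`-Lipschitz map `G` along the momentum step
`a + c • (a - b)`. -/
theorem inner_sub_inner_le_of_momentum_step {E : Type*} [NormedAddCommGroup E]
    [InnerProductSpace ℝ E] {G : E → E} {L c : ℝ} (hG : ∀ y z, ‖G y - G z‖ ≤ L * ‖y - z‖)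
    (hc : 0 ≤ c) {y z a b : E} (hyz : y = z + a + c • (a - b)) :
    ⟪G y, a⟫ - ⟪G z, a⟫ ≤ L * ((1 + 3 / 2 * c) * ‖a‖ ^ 2 + 1 / 2 * c * ‖b‖ ^ 2) := by
  have hnonneg (v : E) : 0 ≤ L * ‖v‖ := by
    simpa using (norm_nonneg _).trans (hG v 0)
  rcases le_or_gt 0 L with hL | hL
  · have hstep : ‖y - z‖ ≤ ‖a‖ + c * (‖a‖ + ‖b‖) := by
      have h : y - z = a + c • (a - b) := by rw [hyz]; abel
      rw [h]
      refine (norm_add_le _ _).trans ?_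
      rw [norm_smul, Real.norm_of_nonneg hc]
      gcongr
      exact norm_sub_le a b
    calc ⟪G y, a⟫ - ⟪G z, a⟫ = ⟪G y - G z, a⟫ := (inner_sub_left _ _ _).symm
      _ ≤ ‖G y - G z‖ * ‖a‖ := real_inner_le_norm _ _
      _ ≤ L * (‖a‖ + c * (‖a‖ + ‖b‖)) * ‖a‖ := by
        gcongr
        exact (hG y z).trans (by gcongr)
      _ = L * ((‖a‖ + c * (‖a‖ + ‖b‖)) * ‖a‖) := by ring
      _ ≤ L * ((1 + 3 / 2 * c) * ‖a‖ ^ 2 + 1 / 2 * c * ‖b‖ ^ 2) := by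
        gcongr
        nlinarith [mul_nonneg hc (sq_nonneg (‖a‖ - ‖b‖))]
  · have hzero (v : E) : v = 0 :=
      norm_le_zero_iff.1 (nonpos_of_mul_nonneg_right (hnonneg v) hL)
    simp [hzero a, hzero b]

/-- One-step momentum estimate (Lemma 3, first part): for `t ≥ 2`,
`⟨∇f(x_t), m_t⟩ ≤ μ⟨∇f(x_{t-1}), m_{t-1}⟩ + (1 + (3/2)λμ)μL‖m_{t-1}‖² + (1/2)λμ²L‖m_{t-2}‖²
  - ⟨∇f(x_t), p_t⟩`. -/
theorem usm_inner_momentum_onestep {d : ℕ}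
    (f : EuclideanSpace ℝ (Fin d) → ℝ) (L μ lam : ℝ)
    (hdiff : Differentiable ℝ f)
    (hLip : ∀ y z : EuclideanSpace ℝ (Fin d),
      ‖gradient f y - gradient f z‖ ≤ L * ‖y - z‖)
    (hμ0 : 0 ≤ μ) (hμ1 : μ < 1) (hlam0 : 0 ≤ lam) (hlam1 : lam ≤ 1 / (1 - μ))
    (T : ℕ) (p m x : ℕ → EuclideanSpace ℝ (Fin d))
    (hm0 : m 0 = 0)
    (hm : ∀ t, 1 ≤ t → t ≤ T → m t = μ • m (t - 1) - p t)
    (hx : ∀ t, 1 ≤ t → t ≤ T → x (t + 1) = x t + m t + (lam * μ) • (m t - m (t - 1)))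
    (t : ℕ) (ht2 : 2 ≤ t) (htT : t ≤ T) :
    ⟪gradient f (x t), m t⟫ ≤ μ * ⟪gradient f (x (t - 1)), m (t - 1)⟫
      + (1 + (3 / 2) * lam * μ) * μ * L * ‖m (t - 1)‖ ^ 2
      + (1 / 2) * lam * μ ^ 2 * L * ‖m (t - 2)‖ ^ 2
      - ⟪gradient f (x t), p t⟫ := by
  obtain ⟨s, rfl⟩ := Nat.exists_eq_add_of_le' ht2
  have hp : m (s + 2) = μ • m (s + 1) - p (s + 2) := hm (s + 2) (by lia) htT
  have hstep : x (s + 2) = x (s + 1) + m (s + 1) + (lam * μ) • (m (s + 1) - m s) :=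
    hx (s + 1) (by lia) (by lia)
  have key := mul_le_mul_of_nonneg_left
    (inner_sub_inner_le_of_momentum_step hLip (mul_nonneg hlam0 hμ0) hstep) hμ0
  simp only [Nat.add_sub_cancel, show s + 2 - 1 = s + 1 from rfl]
  rw [hp, inner_sub_right, real_inner_smul_right]
  linarith
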